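/- arXiv:1503.00745 — 2 statements merged into one kernel-verified Lean document; each statement's English description precedes it below -/
import Mathlib

section
/- Let A be a VAS of dimension d and x, y ∈ ℕ^d. The maximal ideals of ↓Runs(x,y), i.e. the ideals of (PreRuns, ⊴) included in ↓Runs(x,y) and maximal for inclusion among such ideals, are exactly the sets ↓(↑ρ ∩ Runs(x,y)) for runs ρ ∈ Runs(x,y). -/
/-- Configurations of a `d`-dimensional VAS: vectors in `ℕ^d`. -/
abbrev Conf (d : ℕ) := Fin d → ℕ

/-- Actions: vectors in `ℤ^d`. -/
abbrev Act (d : ℕ) := Fin d → ℤ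

/-- Triples in `ℕ^d × ℤ^d × ℕ^d` (potential transitions). -/
abbrev Trip (d : ℕ) := Conf d × Act d × Conf d

/-- Preruns: a source, a word of triples, and a target. -/
abbrev PreRun (d : ℕ) := Conf d × List (Trip d) × Conf d

/-- A transition of the VAS `A`: a triple `(u, a, v)` with `a ∈ A` and
`v = u + a`. -/
def IsTransition {d : ℕ} (A : Set (Act d)) (t : Trip d) : Prop :=
  t.2.1 ∈ A ∧ ∀ i, (t.2.2 i : ℤ) = (t.1 i : ℤ) + t.2.1 i

/-- `ChainFrom x w y` holds when the word `w` of triples chains from `x` to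
`y`: either `w` is empty and `x = y`, or the first source is `x`, the last
target is `y`, and the target of each triple is the source of the next one. -/
def ChainFrom {d : ℕ} : Conf d → List (Trip d) → Conf d → Prop
  | x, [], y => x = y
  | x, t :: w, y => t.1 = x ∧ ChainFrom t.2.2 w y

/-- A run of the VAS `A`: a prerun whose triples are transitions of `A`
chaining from its source to its target. -/
def IsRun {d : ℕ} (A : Set (Act d)) (ρ : PreRun d) : Prop :=
  (∀ t ∈ ρ.2.1, IsTransition A t) ∧ ChainFrom ρ.1 ρ.2.1 ρ.2.2

/-- Ordering on triples: same action, componentwise smaller source and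
target. -/
def TripLE {d : ℕ} (t t' : Trip d) : Prop :=
  t.2.1 = t'.2.1 ∧ (∀ i, t.1 i ≤ t'.1 i) ∧ (∀ i, t.2.2 i ≤ t'.2.2 i)

/-- Sequence embedding between lists, letters compared by `r`. -/
inductive SeqEmb {α : Type*} (r : α → α → Prop) : List α → List α → Prop
  | nil : ∀ l : List α, SeqEmb r [] l
  | cons : ∀ {x y : α} {l l' : List α}, r x y → SeqEmb r l l' →
      SeqEmb r (x :: l) (y :: l')
  | skip : ∀ {y : α} {l l' : List α}, SeqEmb r l l' → SeqEmb r l (y :: l')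

/-- The ordering `⊴` on preruns: componentwise smaller source and target, and
embedding of the words of triples. -/
def PreRunLE {d : ℕ} (ρ ρ' : PreRun d) : Prop :=
  (∀ i, ρ.1 i ≤ ρ'.1 i) ∧ (∀ i, ρ.2.2 i ≤ ρ'.2.2 i) ∧
    SeqEmb TripLE ρ.2.1 ρ'.2.1

/-- Membership in `PreRuns_A`: all actions along the word belong to `A`. -/
def IsPrerun {d : ℕ} (A : Set (Act d)) (ρ : PreRun d) : Prop :=
  ∀ t ∈ ρ.2.1, t.2.1 ∈ A

/-- The set of runs of `A` from `x` to `y`. -/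
def Runs {d : ℕ} (A : Set (Act d)) (x y : Conf d) : Set (PreRun d) :=
  {ρ : PreRun d | IsRun A ρ ∧ ρ.1 = x ∧ ρ.2.2 = y}

/-- Downward closure inside `PreRuns_A` for `⊴`. -/
def DownIn {d : ℕ} (A : Set (Act d)) (Ω : Set (PreRun d)) : Set (PreRun d) :=
  {ρ : PreRun d | IsPrerun A ρ ∧ ∃ ρ' ∈ Ω, PreRunLE ρ ρ'}

/-- Upward closure inside `PreRuns_A` for `⊴`. -/
def UpIn {d : ℕ} (A : Set (Act d)) (Ω : Set (PreRun d)) : Set (PreRun d) :=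
  {ρ : PreRun d | IsPrerun A ρ ∧ ∃ ρ' ∈ Ω, PreRunLE ρ' ρ}

/-- An ideal of `(PreRuns_A, ⊴)`: a nonempty set of preruns, downward-closed
and directed for `⊴`. -/
def IsPrerunIdeal {d : ℕ} (A : Set (Act d)) (I : Set (PreRun d)) : Prop :=
  I ⊆ {ρ : PreRun d | IsPrerun A ρ} ∧ I.Nonempty ∧
    (∀ ρ ρ' : PreRun d, PreRunLE ρ ρ' → ρ' ∈ I → ρ ∈ I) ∧
    (∀ ρ₁ ∈ I, ∀ ρ₂ ∈ I, ∃ ρ ∈ I, PreRunLE ρ₁ ρ ∧ PreRunLE ρ₂ ρ)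

theorem seqEmb_iff_sublistForall₂ {α : Type*} {r : α → α → Prop} {l l' : List α} :
    SeqEmb r l l' ↔ List.SublistForall₂ r l l' := by
  constructor
  · intro h
    induction h with
    | nil l => exact .nil
    | cons hr _ ih => exact .cons hr ih
    | skip _ ih => exact .cons_right ih
  · intro h
    induction h with
    | nil => exact .nil _
    | cons hr _ ih => exact .cons hr ih
    | cons_right _ ih => exact .skip ih

theorem SeqEmb.append {α : Type*} {r : α → α → Prop} {l₁ l₁' l₂ l₂' : List α}
    (h₁ : SeqEmb r l₁ l₁') (h₂ : SeqEmb r l₂ l₂') : SeqEmb r (l₁ ++ l₂) (l₁' ++ l₂') := by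
  induction h₁ with
  | nil l =>
    induction l with
    | nil => exact h₂
    | cons _ _ ih => exact .skip ih
  | cons hr _ ih => exact .cons hr ih
  | skip _ ih => exact .skip ih

theorem SeqEmb.map_right {α : Type*} {r : α → α → Prop} {f : α → α} (hf : ∀ a, r a (f a))
    (l : List α) : SeqEmb r l (l.map f) := by
  induction l with
  | nil => exact .nil _
  | cons a l ih => exact .cons (hf a) ih

theorem SeqEmb.exists_of_cons_left {α : Type*} {r : α → α → Prop} {a : α} {l l' : List α}
    (h : SeqEmb r (a :: l) l') : ∃ p b q, l' = p ++ b :: q ∧ r a b ∧ SeqEmb r l q := by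
  generalize hk : a :: l = k at h
  induction h with
  | nil => simp at hk
  | @cons x y k k' hr hs ih =>
    obtain ⟨rfl, rfl⟩ := List.cons.inj hk
    exact ⟨[], y, k', rfl, hr, hs⟩
  | @skip y k k' hs ih =>
    obtain ⟨p, b, q, rfl, hab, hlq⟩ := ih hk
    exact ⟨y :: p, b, q, rfl, hab, hlq⟩

theorem SeqEmb.exists_mem {α : Type*} {r : α → α → Prop} {l l' : List α} (h : SeqEmb r l l') :
    ∀ a ∈ l, ∃ b ∈ l', r a b := by
  induction h with
  | nil => simp
  | @cons x y l l' hr _ ih =>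
    intro a ha
    rcases List.mem_cons.1 ha with rfl | ha
    · exact ⟨y, by simp, hr⟩
    · obtain ⟨b, hb, hab⟩ := ih a ha
      exact ⟨b, by simp [hb], hab⟩
  | skip _ ih =>
    intro a ha
    obtain ⟨b, hb, hab⟩ := ih a ha
    exact ⟨b, by simp [hb], hab⟩

instance tripLE_isPreorder (d : ℕ) : IsPreorder (Trip d) TripLE where
  refl _ := ⟨rfl, fun _ => le_rfl, fun _ => le_rfl⟩
  trans _ _ _ h h' := ⟨h.1.trans h'.1, fun i => (h.2.1 i).trans (h'.2.1 i),
    fun i => (h.2.2 i).trans (h'.2.2 i)⟩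

theorem SeqEmb.tripLE_refl {d : ℕ} (w : List (Trip d)) : SeqEmb TripLE w w :=
  seqEmb_iff_sublistForall₂.2 (_root_.refl w)

theorem PreRunLE.refl {d : ℕ} (ρ : PreRun d) : PreRunLE ρ ρ :=
  ⟨fun _ => le_rfl, fun _ => le_rfl, .tripLE_refl _⟩

theorem PreRunLE.trans {d : ℕ} {ρ₁ ρ₂ ρ₃ : PreRun d} (h : PreRunLE ρ₁ ρ₂)
    (h' : PreRunLE ρ₂ ρ₃) : PreRunLE ρ₁ ρ₃ :=
  ⟨fun i => (h.1 i).trans (h'.1 i), fun i => (h.2.1 i).trans (h'.2.1 i),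
    seqEmb_iff_sublistForall₂.2 (_root_.trans (seqEmb_iff_sublistForall₂.1 h.2.2)
      (seqEmb_iff_sublistForall₂.1 h'.2.2))⟩

theorem IsPrerun.of_le {d : ℕ} {A : Set (Act d)} {ρ ρ' : PreRun d} (h : PreRunLE ρ ρ')
    (hρ' : IsPrerun A ρ') : IsPrerun A ρ := by
  intro t ht
  obtain ⟨t', ht', hle⟩ := h.2.2.exists_mem t ht
  exact hle.1 ▸ hρ' t' ht'

theorem IsRun.isPrerun {d : ℕ} {A : Set (Act d)} {ρ : PreRun d} (h : IsRun A ρ) :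
    IsPrerun A ρ :=
  fun t ht => (h.1 t ht).1

theorem tripLE_partiallyWellOrderedOn {d : ℕ} {A : Set (Act d)} (hA : A.Finite) :
    {t : Trip d | t.2.1 ∈ A}.PartiallyWellOrderedOn TripLE := by
  have hconf : (Set.univ : Set (Conf d)).PartiallyWellOrderedOn (· ≤ ·) :=
    Set.partiallyWellOrderedOn_univ_iff.2 wellQuasiOrdered_le
  have hact : A.PartiallyWellOrderedOn (· = ·) := hA.partiallyWellOrderedOn
  rw [Set.partiallyWellOrderedOn_iff_exists_lt]
  intro f hf
  obtain ⟨m, n, hmn, h₁, h₂, h₃⟩ := (hconf.prod (hact.prod hconf)).exists_lt (f := f)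
    (fun n => ⟨trivial, hf n, trivial⟩)
  exact ⟨m, n, hmn, h₂, h₁, h₃⟩

/-- The runs between two configurations have a finite basis. -/
theorem exists_finset_basis_runs {d : ℕ} {A : Set (Act d)} (hA : A.Finite) (x y : Conf d) :
    ∃ F : Finset (PreRun d), (∀ ρ ∈ F, ρ ∈ Runs A x y) ∧
      ∀ σ ∈ Runs A x y, ∃ ρ ∈ F, PreRunLE ρ σ := by
  by_contra! hF
  obtain ⟨f, hf, hbad⟩ := exists_seq_of_forall_finset_exists (· ∈ Runs A x y)
    (fun ρ σ => ¬ PreRunLE ρ σ) hF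
  obtain ⟨m, n, hmn, hle⟩ :=
    (tripLE_partiallyWellOrderedOn hA).partiallyWellOrderedOn_sublistForall₂.exists_lt
      (f := fun n => (f n).2.1) (fun n => (hf n).1.isPrerun)
  refine hbad m n hmn ⟨?_, ?_, seqEmb_iff_sublistForall₂.2 hle⟩
  · rw [(hf m).2.1, (hf n).2.1]
    exact fun _ => le_rfl
  · rw [(hf m).2.2, (hf n).2.2]
    exact fun _ => le_rfl

theorem isRun_nil_iff {d : ℕ} {A : Set (Act d)} {x y : Conf d} :
    IsRun A (x, [], y) ↔ x = y := by
  simp [IsRun, ChainFrom]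

theorem isRun_cons_iff {d : ℕ} {A : Set (Act d)} {x y : Conf d} {t : Trip d}
    {w : List (Trip d)} :
    IsRun A (x, t :: w, y) ↔ IsTransition A t ∧ t.1 = x ∧ IsRun A (t.2.2, w, y) := by
  simp only [IsRun, ChainFrom, List.forall_mem_cons]
  tauto

theorem isRun_append_iff {d : ℕ} {A : Set (Act d)} {x y : Conf d} {w w' : List (Trip d)} :
    IsRun A (x, w ++ w', y) ↔ ∃ z, IsRun A (x, w, z) ∧ IsRun A (z, w', y) := by
  induction w generalizing x with
  | nil => simp [isRun_nil_iff]
  | cons t w ih =>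
    simp only [List.cons_append, isRun_cons_iff, ih]
    constructor
    · rintro ⟨h₁, h₂, z, h₃, h₄⟩
      exact ⟨z, ⟨h₁, h₂, h₃⟩, h₄⟩
    · rintro ⟨z, ⟨h₁, h₂, h₃⟩, h₄⟩
      exact ⟨h₁, h₂, z, h₃, h₄⟩

/-- Translation of a triple by a configuration. -/
def Trip.shift {d : ℕ} (e : Conf d) (t : Trip d) : Trip d := (t.1 + e, t.2.1, t.2.2 + e)

theorem Trip.le_shift {d : ℕ} (e : Conf d) (t : Trip d) : TripLE t (t.shift e) :=
  ⟨rfl, fun _ => Nat.le_add_right _ _, fun _ => Nat.le_add_right _ _⟩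

/-- Runs are stable under translation. -/
theorem IsRun.shift {d : ℕ} {A : Set (Act d)} {x y : Conf d} {w : List (Trip d)}
    (h : IsRun A (x, w, y)) (e : Conf d) : IsRun A (x + e, w.map (Trip.shift e), y + e) := by
  induction w generalizing x with
  | nil => simpa [isRun_nil_iff] using h
  | cons t w ih =>
    obtain ⟨⟨hA, ht⟩, rfl, hw⟩ := isRun_cons_iff.1 h
    refine isRun_cons_iff.2 ⟨⟨hA, fun i => ?_⟩, rfl, ih hw⟩
    have := ht i
    simp only [Trip.shift, Pi.add_apply]
    push_cast
    omega

/-- Two runs that pass over a common configuration `c` can be performed one after the other. -/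
theorem IsRun.exists_sum {d : ℕ} {A : Set (Act d)} {c x₁ y₁ x₂ y₂ : Conf d}
    {w₁ w₂ : List (Trip d)} (h₁ : IsRun A (x₁, w₁, y₁)) (h₂ : IsRun A (x₂, w₂, y₂))
    (hy₁ : c ≤ y₁) (hx₂ : c ≤ x₂) :
    ∃ w, IsRun A (x₁ + (x₂ - c), w, y₂ + (y₁ - c)) ∧ SeqEmb TripLE w₁ w ∧
      SeqEmb TripLE w₂ w := by
  refine ⟨w₁.map (Trip.shift (x₂ - c)) ++ w₂.map (Trip.shift (y₁ - c)),
    isRun_append_iff.2 ⟨_, h₁.shift _, ?_⟩, ?_, ?_⟩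
  · have : y₁ + (x₂ - c) = x₂ + (y₁ - c) := by
      ext i
      have : c i ≤ y₁ i := hy₁ i
      have : c i ≤ x₂ i := hx₂ i
      simp only [Pi.add_apply, Pi.sub_apply]
      omega
    rw [this]
    exact h₂.shift _
  · simpa using (SeqEmb.map_right (Trip.le_shift _) w₁).append (.nil _)
  · simpa using (SeqEmb.nil _).append (SeqEmb.map_right (Trip.le_shift _) w₂)

/-- Amalgamation of two runs above a common run. -/
theorem IsRun.exists_amalgam {d : ℕ} {A : Set (Act d)} {x y x₁ y₁ x₂ y₂ : Conf d}
    {w w₁ w₂ : List (Trip d)} (h : IsRun A (x, w, y))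
    (h₁ : IsRun A (x₁, w₁, y₁)) (h₂ : IsRun A (x₂, w₂, y₂))
    (hw₁ : SeqEmb TripLE w w₁) (hw₂ : SeqEmb TripLE w w₂)
    (hx₂ : x ≤ x₂) (hy₁ : y ≤ y₁) :
    ∃ w', IsRun A (x₁ + (x₂ - x), w', y₂ + (y₁ - y)) ∧ SeqEmb TripLE w₁ w' ∧
      SeqEmb TripLE w₂ w' := by
  induction w generalizing x x₁ x₂ w₁ w₂ with
  | nil =>
    obtain rfl := isRun_nil_iff.1 h
    exact h₁.exists_sum h₂ hy₁ hx₂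
  | cons t w ih =>
    obtain ⟨⟨hA, ht⟩, rfl, hw⟩ := isRun_cons_iff.1 h
    obtain ⟨p₁, t₁, q₁, rfl, hle₁, hq₁⟩ := hw₁.exists_of_cons_left
    obtain ⟨p₂, t₂, q₂, rfl, hle₂, hq₂⟩ := hw₂.exists_of_cons_left
    obtain ⟨z₁, hp₁, hr₁⟩ := isRun_append_iff.1 h₁
    obtain ⟨z₂, hp₂, hr₂⟩ := isRun_append_iff.1 h₂
    obtain ⟨⟨-, ht₁⟩, rfl, hs₁⟩ := isRun_cons_iff.1 hr₁
    obtain ⟨⟨-, ht₂⟩, rfl, hs₂⟩ := isRun_cons_iff.1 hr₂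
    obtain ⟨p, hp, hp₁', hp₂'⟩ := hp₁.exists_sum hp₂ hle₁.2.1 hx₂
    obtain ⟨q, hq, hq₁', hq₂'⟩ := ih hw hs₁ hs₂ hq₁ hq₂ hle₂.2.2
    refine ⟨p ++ (t₂.1 + (t₁.1 - t.1), t.2.1, t₁.2.2 + (t₂.2.2 - t.2.2)) :: q,
      isRun_append_iff.2 ⟨_, hp, isRun_cons_iff.2 ⟨⟨hA, fun i => ?_⟩, rfl, hq⟩⟩,
      hp₁'.append (.cons ⟨hle₁.1.symm, fun i => ?_, fun i => ?_⟩ hq₁'),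
      hp₂'.append (.cons ⟨hle₂.1.symm, fun i => ?_, fun i => ?_⟩ hq₂')⟩
    all_goals
      have e := ht i
      have e₁ := ht₁ i
      have e₂ := ht₂ i
      rw [← hle₁.1] at e₁
      rw [← hle₂.1] at e₂
      have := hle₁.2.1 i
      have := hle₁.2.2 i
      have := hle₂.2.1 i
      have := hle₂.2.2 i
      simp only [Pi.add_apply, Pi.sub_apply]
      omega

theorem Runs.exists_amalgam {d : ℕ} {A : Set (Act d)} {x y : Conf d} {ρ ρ₁ ρ₂ : PreRun d}
    (h : ρ ∈ Runs A x y) (h₁ : ρ₁ ∈ Runs A x y) (h₂ : ρ₂ ∈ Runs A x y)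
    (hle₁ : PreRunLE ρ ρ₁) (hle₂ : PreRunLE ρ ρ₂) :
    ∃ σ ∈ Runs A x y, PreRunLE ρ₁ σ ∧ PreRunLE ρ₂ σ := by
  obtain ⟨_, w, _⟩ := ρ
  obtain ⟨_, w₁, _⟩ := ρ₁
  obtain ⟨_, w₂, _⟩ := ρ₂
  obtain ⟨h, rfl, rfl⟩ := h
  obtain ⟨h₁, rfl, rfl⟩ := h₁
  obtain ⟨h₂, rfl, rfl⟩ := h₂
  obtain ⟨w', hw', hw₁, hw₂⟩ := h.exists_amalgam h₁ h₂ hle₁.2.2 hle₂.2.2 le_rfl le_rfl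
  simp only [tsub_self, add_zero] at hw'
  exact ⟨_, ⟨hw', rfl, rfl⟩, ⟨fun _ => le_rfl, fun _ => le_rfl, hw₁⟩,
    ⟨fun _ => le_rfl, fun _ => le_rfl, hw₂⟩⟩

theorem mem_downIn_upIn_inter_runs_iff {d : ℕ} {A : Set (Act d)} {x y : Conf d}
    {ρ σ : PreRun d} :
    σ ∈ DownIn A (UpIn A {ρ} ∩ Runs A x y) ↔
      ∃ τ ∈ Runs A x y, PreRunLE ρ τ ∧ PreRunLE σ τ := by
  constructor
  · rintro ⟨-, τ, ⟨⟨-, _, rfl, hρ⟩, hτ⟩, hσ⟩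
    exact ⟨τ, hτ, hρ, hσ⟩
  · rintro ⟨τ, hτ, hρ, hσ⟩
    exact ⟨hτ.1.isPrerun.of_le hσ, τ, ⟨⟨hτ.1.isPrerun, ρ, rfl, hρ⟩, hτ⟩, hσ⟩

theorem downIn_upIn_inter_runs_subset {d : ℕ} {A : Set (Act d)} {x y : Conf d} (ρ : PreRun d) :
    DownIn A (UpIn A {ρ} ∩ Runs A x y) ⊆ DownIn A (Runs A x y) :=
  fun _ ⟨hσ, τ, hτ, hle⟩ => ⟨hσ, τ, hτ.2, hle⟩

theorem isPrerunIdeal_downIn_upIn_inter_runs {d : ℕ} {A : Set (Act d)} {x y : Conf d}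
    {ρ : PreRun d} (hρ : ρ ∈ Runs A x y) :
    IsPrerunIdeal A (DownIn A (UpIn A {ρ} ∩ Runs A x y)) := by
  refine ⟨fun _ h => h.1, ⟨ρ, mem_downIn_upIn_inter_runs_iff.2 ⟨ρ, hρ, .refl ρ, .refl ρ⟩⟩,
    fun σ σ' hle hσ' => ?_, fun σ₁ h₁ σ₂ h₂ => ?_⟩
  · obtain ⟨τ, hτ, hρτ, hσ'⟩ := mem_downIn_upIn_inter_runs_iff.1 hσ'
    exact mem_downIn_upIn_inter_runs_iff.2 ⟨τ, hτ, hρτ, hle.trans hσ'⟩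
  · obtain ⟨τ₁, hτ₁, hρ₁, hσ₁⟩ := mem_downIn_upIn_inter_runs_iff.1 h₁
    obtain ⟨τ₂, hτ₂, hρ₂, hσ₂⟩ := mem_downIn_upIn_inter_runs_iff.1 h₂
    obtain ⟨τ, hτ, hle₁, hle₂⟩ := Runs.exists_amalgam hρ hτ₁ hτ₂ hρ₁ hρ₂
    exact ⟨τ, mem_downIn_upIn_inter_runs_iff.2 ⟨τ, hτ, hρ₁.trans hle₁, .refl τ⟩,
      hσ₁.trans hle₁, hσ₂.trans hle₂⟩

/-- An ideal covered by a finite family of downward-closed sets is included in one of them. -/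
theorem IsPrerunIdeal.exists_subset_of_finset_cover {d : ℕ} {A : Set (Act d)}
    {I : Set (PreRun d)} (hI : IsPrerunIdeal A I) {ι : Type*} (F : Finset ι)
    (D : ι → Set (PreRun d))
    (hD : ∀ k ∈ F, ∀ σ σ' : PreRun d, PreRunLE σ σ' → σ' ∈ D k → σ ∈ D k)
    (hcover : ∀ σ ∈ I, ∃ k ∈ F, σ ∈ D k) : ∃ k ∈ F, I ⊆ D k := by
  classical
  by_contra! hF
  suffices ∃ τ ∈ I, ∀ k ∈ F, τ ∉ D k by
    obtain ⟨τ, hτ, hnot⟩ := this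
    obtain ⟨k, hk, hmem⟩ := hcover τ hτ
    exact hnot k hk hmem
  clear hcover
  induction F using Finset.induction_on with
  | empty =>
    obtain ⟨τ, hτ⟩ := hI.2.1
    exact ⟨τ, hτ, by simp⟩
  | insert k F _ ih =>
    obtain ⟨τ, hτ, hnot⟩ := ih (fun j hj => hD j (Finset.mem_insert_of_mem hj))
      (fun j hj => hF j (Finset.mem_insert_of_mem hj))
    obtain ⟨σ, hσ, hσk⟩ := Set.not_subset.1 (hF k (Finset.mem_insert_self k F))
    obtain ⟨υ, hυ, hτυ, hσυ⟩ := hI.2.2.2 τ hτ σ hσ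
    refine ⟨υ, hυ, fun j hj hmem => ?_⟩
    have hlow := hD j hj
    rcases Finset.mem_insert.1 hj with rfl | hj
    · exact hσk (hlow σ υ hσυ hmem)
    · exact hnot j hj (hlow τ υ hτυ hmem)

/-- The maximal ideals of `↓Runs(x,y)` — ideals of `(PreRuns_A, ⊴)` included in
`↓Runs(x,y)` and maximal for inclusion among such ideals — are exactly the
sets `↓(↑ρ ∩ Runs(x,y))` for runs `ρ ∈ Runs(x,y)`. -/
theorem maximal_ideals_of_runs {d : ℕ} (A : Set (Act d)) (hA : A.Finite)
    (x y : Conf d) :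
    {I : Set (PreRun d) |
        IsPrerunIdeal A I ∧ I ⊆ DownIn A (Runs A x y) ∧
        ∀ J : Set (PreRun d), IsPrerunIdeal A J → J ⊆ DownIn A (Runs A x y) →
          I ⊆ J → J = I} =
      {I : Set (PreRun d) |
        ∃ ρ ∈ Runs A x y, I = DownIn A (UpIn A {ρ} ∩ Runs A x y)} := by
  ext I
  constructor
  · rintro ⟨hI, hsub, hmax⟩
    obtain ⟨F, hF, hbasis⟩ := exists_finset_basis_runs hA x y
    obtain ⟨ρ, hρ, hle⟩ := hI.exists_subset_of_finset_cover F
      (fun ρ => DownIn A (UpIn A {ρ} ∩ Runs A x y))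
      (fun ρ hρ => (isPrerunIdeal_downIn_upIn_inter_runs (hF ρ hρ)).2.2.1) (fun σ hσ => by
        obtain ⟨-, τ, hτ, hστ⟩ := hsub hσ
        obtain ⟨ρ, hρ, hρτ⟩ := hbasis τ hτ
        exact ⟨ρ, hρ, mem_downIn_upIn_inter_runs_iff.2 ⟨τ, hτ, hρτ, hστ⟩⟩)
    exact ⟨ρ, hF ρ hρ, (hmax _ (isPrerunIdeal_downIn_upIn_inter_runs (hF ρ hρ))
      (downIn_upIn_inter_runs_subset ρ) hle).symm⟩
  · rintro ⟨ρ, hρ, rfl⟩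
    refine ⟨isPrerunIdeal_downIn_upIn_inter_runs hρ, downIn_upIn_inter_runs_subset ρ,
      fun J hJ hJsub hle => Set.Subset.antisymm (fun σ hσ => ?_) hle⟩
    have hρJ : ρ ∈ J := hle (mem_downIn_upIn_inter_runs_iff.2 ⟨ρ, hρ, .refl ρ, .refl ρ⟩)
    obtain ⟨υ, hυ, hρυ, hσυ⟩ := hJ.2.2.2 ρ hρJ σ hσ
    obtain ⟨-, τ, hτ, hυτ⟩ := hJsub hυ
    exact mem_downIn_upIn_inter_runs_iff.2 ⟨τ, hτ, hρυ.trans hυτ, hσυ.trans hυτ⟩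
end

section
/- Let γ = (c,P) with c ∈ ℕ^d and P ⊆ ℕ^d × ℕ^d a periodic set included in ↝_c. Then ↓Ω_γ = ↓s_γ^in × (↓E_γ)* × ↓s_γ^out; that is, the downward closure of Ω_γ inside (PreRuns, ⊴) equals the set of preruns (x,w,y) such that x ≤ s_γ^in and y ≤ s_γ^out componentwise (in ℕ_ω^d) and every letter of w lies below some element of E_γ for the ordering (u,a,v) ≤ (u',a',v') iff a = a', u ≤ u' and v ≤ v'. -/
/-- A subset `P` of `ℕ^d × ℕ^d` is periodic if it contains the zero vector and
is closed under componentwise addition. -/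
def PeriodicPairs {d : ℕ} (P : Set (Conf d × Conf d)) : Prop :=
  (0, 0) ∈ P ∧ ∀ p ∈ P, ∀ q ∈ P, p + q ∈ P

/-- The transformer relation with capacity `c`: `u ↝_c v` iff there is a run
from `u + c` to `v + c`. -/
def Transformer {d : ℕ} (A : Set (Act d)) (c : Conf d) (u v : Conf d) : Prop :=
  ∃ w : List (Trip d), IsRun A (u + c, w, v + c)

/-- Membership in `Ω_γ` for `γ = (c, P)`: the runs from `c + u` to `c + v`
with `(u, v) ∈ P`. -/
def InOmega {d : ℕ} (A : Set (Act d)) (c : Conf d) (P : Set (Conf d × Conf d))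
    (ρ : PreRun d) : Prop :=
  IsRun A ρ ∧ ∃ p ∈ P, ρ.1 = c + p.1 ∧ ρ.2.2 = c + p.2

/-- The configuration `q` occurs along the prerun `ρ`. -/
def OccursIn {d : ℕ} (q : Conf d) (ρ : PreRun d) : Prop :=
  q = ρ.1 ∨ q = ρ.2.2 ∨ ∃ t ∈ ρ.2.1, q = t.1 ∨ q = t.2.2

/-- `Q_γ`: the set of configurations occurring along runs of `Ω_γ`. -/
def Qgamma {d : ℕ} (A : Set (Act d)) (c : Conf d)
    (P : Set (Conf d × Conf d)) : Set (Conf d) :=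
  {q : Conf d | ∃ ρ : PreRun d, InOmega A c P ρ ∧ OccursIn q ρ}

/-- `F_γ`: the set of indices on which `Q_γ` is bounded, i.e. such that
`{q i | q ∈ Q_γ}` is finite. -/
def Fgamma {d : ℕ} (A : Set (Act d)) (c : Conf d)
    (P : Set (Conf d × Conf d)) : Set (Fin d) :=
  {i : Fin d | ((fun q : Conf d => q i) '' Qgamma A c P).Finite}

/-- Partial configurations: vectors in `ℕ_ω^d 
  (`ℕ_ω = ℕ ∪ {ω}`, represented by `ℕ∞`, with `ω = ⊤`). -/
abbrev PConf (d : ℕ) := Fin d → ℕ∞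

/-- Embedding of configurations into partial configurations. -/
def toPC {d : ℕ} (q : Conf d) : PConf d := fun i => (q i : ℕ∞)

open scoped Classical in
/-- The projection `π_F`: keeps the coordinates in `F` and sets the others
to `ω`. -/
noncomputable def projPC {d : ℕ} (F : Set (Fin d)) (u : PConf d) : PConf d :=
  fun i => if i ∈ F then u i else ⊤

/-- The finite (defined) coordinates of a partial configuration. -/
def FinCoords {d : ℕ} (u : PConf d) : Set (Fin d) := {i | u i ≠ ⊤}

/-- A partial transition: a triple `(u, a, v)` in `ℕ_ω^d × A × ℕ_ω^d` with
`v = u + a`, where `ω + k = ω`. -/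
def IsPartialTransition {d : ℕ} (A : Set (Act d))
    (e : PConf d × Act d × PConf d) : Prop :=
  e.2.1 ∈ A ∧ ∀ i,
    (e.1 i = ⊤ ∧ e.2.2 i = ⊤) ∨
    ∃ m n : ℕ, e.1 i = (m : ℕ∞) ∧ e.2.2 i = (n : ℕ∞) ∧
      (n : ℤ) = (m : ℤ) + e.2.1 i

/-- Paths in a labelled graph with edge set `E`: `PathIn E p σ q` holds iff
there is a path from `p` to `q` whose sequence of action labels is `σ`. -/
inductive PathIn {d : ℕ} (E : Set (PConf d × Act d × PConf d)) :
    PConf d → List (Act d) → PConf d → Prop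
  | nil (p : PConf d) : PathIn E p [] p
  | cons {p q r : PConf d} {a : Act d} {σ : List (Act d)} :
      (p, a, q) ∈ E → PathIn E q σ r → PathIn E p (a :: σ) r

/-- A witness graph `(S, E, s)` for the VAS `A`: a nonempty finite set `S` of
partial configurations with common set `F` of finite coordinates, a finite set
`E ⊆ S × A × S` of partial transitions, a distinguished state `s ∈ S`, the
graph being strongly connected. -/
def IsWitnessGraph {d : ℕ} (A : Set (Act d)) (F : Set (Fin d))
    (S : Set (PConf d)) (E : Set (PConf d × Act d × PConf d))
    (s : PConf d) : Prop :=
  S.Nonempty ∧ S.Finite ∧ (∀ p ∈ S, FinCoords p = F) ∧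
  E.Finite ∧ (∀ e ∈ E, e.1 ∈ S ∧ e.2.2 ∈ S ∧ IsPartialTransition A e) ∧
  s ∈ S ∧ ∀ p ∈ S, ∀ q ∈ S, ∃ σ : List (Act d), PathIn E p σ q

/-- A marked witness graph `(s^in, (S,E,s), s^out)`: a witness graph together
with partial configurations `s^in, s^out` whose sets `F^in, F^out` of finite
coordinates contain `F`, and with `π_F s^in = π_F s^out = s`. -/
def IsMarkedWitnessGraph {d : ℕ} (A : Set (Act d))
    (F Fin' Fout : Set (Fin d)) (S : Set (PConf d))
    (E : Set (PConf d × Act d × PConf d)) (s sin sout : PConf d) : Prop :=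
  IsWitnessGraph A F S E s ∧ F ⊆ Fin' ∧ F ⊆ Fout ∧
  FinCoords sin = Fin' ∧ FinCoords sout = Fout ∧
  projPC F sin = s ∧ projPC F sout = s

/-- The label of a prerun: its sequence of actions. -/
def labelOf {d : ℕ} (ρ : PreRun d) : List (Act d) := ρ.2.1.map (fun t => t.2.1)

/-- Membership in `Ω_M` for a marked witness graph
`M = (s^in, (S,E,s), s^out)`: the runs `x →σ y` such that `σ` labels a cycle
on `s` in the graph, `π_{F^in} x = s^in` and `π_{F^out} y = s^out`. -/
def InOmegaM {d : ℕ} (A : Set (Act d)) (Fin' Fout : Set (Fin d))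
    (E : Set (PConf d × Act d × PConf d)) (s sin sout : PConf d)
    (ρ : PreRun d) : Prop :=
  IsRun A ρ ∧ PathIn E s (labelOf ρ) s ∧
  projPC Fin' (toPC ρ.1) = sin ∧ projPC Fout (toPC ρ.2.2) = sout

/-- `F_γ^in`: the indices `i` with `u i = 0` for every `(u,v) ∈ P`. -/
def FinGamma {d : ℕ} (P : Set (Conf d × Conf d)) : Set (Fin d) :=
  {i : Fin d | ∀ p ∈ P, p.1 i = 0}

/-- `F_γ^out`: the indices `i` with `v i = 0` for every `(u,v) ∈ P`. -/
def FoutGamma {d : ℕ} (P : Set (Conf d × Conf d)) : Set (Fin d) :=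
  {i : Fin d | ∀ p ∈ P, p.2 i = 0}

/-- `s_γ = π_{F_γ}(c)`. -/
noncomputable def sgamma {d : ℕ} (A : Set (Act d)) (c : Conf d)
    (P : Set (Conf d × Conf d)) : PConf d :=
  projPC (Fgamma A c P) (toPC c)

/-- `S_γ = π_{F_γ}(Q_γ)`. -/
noncomputable def Sgamma {d : ℕ} (A : Set (Act d)) (c : Conf d)
    (P : Set (Conf d × Conf d)) : Set (PConf d) :=
  (fun q : Conf d => projPC (Fgamma A c P) (toPC q)) '' Qgamma A c P

/-- `E_γ`: the partial transitions `(π_{F_γ} q, a, π_{F_γ} q')` for transitions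
`(q, a, q')` occurring along runs of `Ω_γ`. -/
noncomputable def Egamma {d : ℕ} (A : Set (Act d)) (c : Conf d)
    (P : Set (Conf d × Conf d)) : Set (PConf d × Act d × PConf d) :=
  {e : PConf d × Act d × PConf d | ∃ t : Trip d,
    (∃ ρ : PreRun d, InOmega A c P ρ ∧ t ∈ ρ.2.1) ∧
    e = (projPC (Fgamma A c P) (toPC t.1), t.2.1,
         projPC (Fgamma A c P) (toPC t.2.2))}

/-- `s_γ^in = π_{F_γ^in}(c)`. -/
noncomputable def sinGamma {d : ℕ} (c : Conf d)
    (P : Set (Conf d × Conf d)) : PConf d :=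
  projPC (FinGamma P) (toPC c)

/-- `s_γ^out = π_{F_γ^out}(c)`. -/
noncomputable def soutGamma {d : ℕ} (c : Conf d)
    (P : Set (Conf d × Conf d)) : PConf d :=
  projPC (FoutGamma P) (toPC c)

theorem IsTransition.shift {d : ℕ} {A : Set (Act d)} {t : Trip d} (h : IsTransition A t)
    (z : Conf d) : IsTransition A (z + t.1, t.2.1, z + t.2.2) := by
  refine ⟨h.1, fun i => ?_⟩
  have := h.2 i
  simp only [Pi.add_apply]
  push_cast
  linarith

/-- `Covers A x l y` holds when some run of `A` from `x` to `y` has a word in which `l` embeds. -/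
inductive Covers {d : ℕ} (A : Set (Act d)) : Conf d → List (Trip d) → Conf d → Prop
  | refl (x : Conf d) : Covers A x [] x
  | skip {t : Trip d} {l : List (Trip d)} {y : Conf d} :
      IsTransition A t → Covers A t.2.2 l y → Covers A t.1 l y
  | keep {s t : Trip d} {l : List (Trip d)} {y : Conf d} :
      IsTransition A t → TripLE s t → Covers A t.2.2 l y → Covers A t.1 (s :: l) y

namespace Covers

variable {d : ℕ} {A : Set (Act d)}

theorem trans {x y z : Conf d} {l l' : List (Trip d)} (h : Covers A x l y)
    (h' : Covers A y l' z) : Covers A x (l ++ l') z := by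
  induction h with
  | refl => exact h'
  | skip ht _ ih => exact .skip ht (ih h')
  | keep ht hs _ ih => exact .keep ht hs (ih h')

theorem shift {x y : Conf d} {l : List (Trip d)} (h : Covers A x l y) (z : Conf d) :
    Covers A (z + x) l (z + y) := by
  induction h with
  | refl => exact .refl _
  | skip ht _ ih => exact .skip (ht.shift z) ih
  | keep ht hs _ ih =>
    refine .keep (ht.shift z) ⟨hs.1, fun i => ?_, fun i => ?_⟩ ih
    · exact (hs.2.1 i).trans (Nat.le_add_left _ _)
    · exact (hs.2.2 i).trans (Nat.le_add_left _ _)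

/-- Runs between configurations sharing the capacity `c` can be added without adding `c` twice. -/
theorem add_capacity {c u v u' v' : Conf d} {l l' : List (Trip d)}
    (h : Covers A (c + u) l (c + v)) (h' : Covers A (c + u') l' (c + v')) :
    Covers A (c + (u + u')) (l ++ l') (c + (v + v')) := by
  have h₁ := h.shift u'
  have h₂ := h'.shift v
  rw [show u' + (c + u) = c + (u + u') by abel, show u' + (c + v) = v + (c + u') by abel] at h₁
  rw [show v + (c + v') = c + (v + v') by abel] at h₂
  exact h₁.trans h₂

theorem exists_isRun {x y : Conf d} {l : List (Trip d)} (h : Covers A x l y) :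
    ∃ w, IsRun A (x, w, y) ∧ SeqEmb TripLE l w := by
  induction h with
  | refl x => exact ⟨[], ⟨by simp, rfl⟩, .nil _⟩
  | @skip t l y ht _ ih =>
    obtain ⟨w, ⟨hw, hc⟩, hl⟩ := ih
    exact ⟨t :: w, ⟨List.forall_mem_cons.2 ⟨ht, hw⟩, rfl, hc⟩, .skip hl⟩
  | @keep s t l y ht hs _ ih =>
    obtain ⟨w, ⟨hw, hc⟩, hl⟩ := ih
    exact ⟨t :: w, ⟨List.forall_mem_cons.2 ⟨ht, hw⟩, rfl, hc⟩, .cons hs hl⟩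

end Covers

theorem IsRun.covers_nil {d : ℕ} {A : Set (Act d)} {w : List (Trip d)} {x y : Conf d}
    (h : IsRun A (x, w, y)) : Covers A x [] y := by
  induction w generalizing x with
  | nil => obtain rfl : x = y := h.2; exact .refl _
  | cons t w ih =>
    obtain ⟨hw, rfl, hc⟩ := h
    rw [List.forall_mem_cons] at hw
    exact .skip hw.1 (ih ⟨hw.2, hc⟩)

theorem IsRun.covers_of_mem {d : ℕ} {A : Set (Act d)} {w : List (Trip d)} {x y : Conf d}
    (h : IsRun A (x, w, y)) {t : Trip d} (ht : t ∈ w) :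
    Covers A x [] t.1 ∧ Covers A t.2.2 [] y := by
  induction w generalizing x with
  | nil => simp at ht
  | cons s w ih =>
    obtain ⟨hw, rfl, hc⟩ := h
    rw [List.forall_mem_cons] at hw
    rcases List.mem_cons.1 ht with rfl | ht
    · exact ⟨.refl _, IsRun.covers_nil ⟨hw.2, hc⟩⟩
    · obtain ⟨h₁, h₂⟩ := ih ⟨hw.2, hc⟩ ht
      exact ⟨.skip hw.1 h₁, h₂⟩

theorem SeqEmb.exists_of_mem {α : Type*} {r : α → α → Prop} {l l' : List α}
    (h : SeqEmb r l l') {a : α} (ha : a ∈ l) : ∃ b ∈ l', r a b := by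
  induction h with
  | nil => simp at ha
  | cons hr _ ih =>
    rcases List.mem_cons.1 ha with rfl | ha
    · exact ⟨_, List.mem_cons_self, hr⟩
    · obtain ⟨b, hb, hab⟩ := ih ha
      exact ⟨b, List.mem_cons_of_mem _ hb, hab⟩
  | skip _ ih =>
    obtain ⟨b, hb, hab⟩ := ih ha
    exact ⟨b, List.mem_cons_of_mem _ hb, hab⟩

/-- A periodic set of pairs, as an additive submonoid. -/
def PeriodicPairs.toAddSubmonoid {d : ℕ} {P : Set (Conf d × Conf d)} (h : PeriodicPairs P) :
    AddSubmonoid (Conf d × Conf d) where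
  carrier := P
  zero_mem' := h.1
  add_mem' {p q} hp hq := h.2 p hp q hq

theorem AddSubmonoid.exists_mem_le_of_pos {d : ℕ} (M : AddSubmonoid (Conf d)) (F : Set (Fin d))
    (hF : ∀ i ∉ F, ∃ x ∈ M, 0 < x i) (z : Conf d) : ∃ x ∈ M, ∀ i ∉ F, z i ≤ x i := by
  have hF' : ∀ i, ∃ x ∈ M, i ∉ F → 0 < x i := fun i => by
    by_cases hi : i ∈ F
    · exact ⟨0, M.zero_mem, fun h => absurd hi h⟩
    · obtain ⟨x, hx, hpos⟩ := hF i hi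
      exact ⟨x, hx, fun _ => hpos⟩
  choose g hgM hg using hF'
  refine ⟨∑ i, z i • g i, M.sum_mem fun i _ => M.nsmul_mem (hgM i) _, fun i hi => ?_⟩
  rw [Finset.sum_apply]
  calc z i ≤ (z i • g i) i := Nat.le_mul_of_pos_right _ (hg i hi)
    _ ≤ _ := Finset.single_le_sum (f := fun j => (z j • g j) i) (fun _ _ => Nat.zero_le _)
        (Finset.mem_univ i)

/-- The vectors `x` such that `p.1 ↝_c x ↝_c p.2` for some `p ∈ P`. -/
def intraproductions {d : ℕ} (A : Set (Act d)) (c : Conf d) {P : Set (Conf d × Conf d)}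
    (hper : PeriodicPairs P) : AddSubmonoid (Conf d) where
  carrier := {x | ∃ p ∈ P, Covers A (c + p.1) [] (c + x) ∧ Covers A (c + x) [] (c + p.2)}
  zero_mem' := ⟨(0, 0), hper.1, .refl _, .refl _⟩
  add_mem' := by
    rintro x y ⟨p, hp, h₁, h₂⟩ ⟨q, hq, h₃, h₄⟩
    exact ⟨p + q, hper.2 p hp q hq, h₁.add_capacity h₃, h₂.add_capacity h₄⟩

section Periodic

variable {d : ℕ} {A : Set (Act d)} {c : Conf d} {P : Set (Conf d × Conf d)}

theorem exists_covers_of_mem_Qgamma {q : Conf d} (hq : q ∈ Qgamma A c P) :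
    ∃ p ∈ P, Covers A (c + p.1) [] q ∧ Covers A q [] (c + p.2) := by
  obtain ⟨⟨x, w, y⟩, ⟨hrun, p, hp, rfl, rfl⟩, hocc⟩ := hq
  refine ⟨p, hp, ?_⟩
  rcases hocc with rfl | rfl | ⟨t, ht, rfl | rfl⟩
  · exact ⟨.refl _, hrun.covers_nil⟩
  · exact ⟨hrun.covers_nil, .refl _⟩
  · obtain ⟨h₁, h₂⟩ := hrun.covers_of_mem ht
    exact ⟨h₁, .skip (hrun.1 t ht) h₂⟩
  · obtain ⟨h₁, h₂⟩ := hrun.covers_of_mem ht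
    exact ⟨h₁.trans (.skip (hrun.1 t ht) (.refl _)), h₂⟩

theorem exists_intraproduction_pos (hper : PeriodicPairs P) {i : Fin d}
    (hi : i ∉ Fgamma A c P) : ∃ x ∈ intraproductions A c hper, 0 < x i := by
  have hinf : ((fun q : Conf d => q i) '' Qgamma A c P).Infinite := hi
  have hmem : ∀ n, ∃ q ∈ Qgamma A c P, q i = hinf.natEmbedding _ n := fun n =>
    (hinf.natEmbedding _ n).2
  choose f hfQ hf using hmem
  obtain ⟨m, n, hmn, hle⟩ := wellQuasiOrdered_le f
  obtain ⟨p, hp, hp₁, hp₂⟩ := exists_covers_of_mem_Qgamma (hfQ m)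
  obtain ⟨q, hq, hq₁, hq₂⟩ := exists_covers_of_mem_Qgamma (hfQ n)
  obtain ⟨x, hx⟩ := le_iff_exists_add.1 hle
  have hne : f m i ≠ f n i := fun h => hmn.ne <| by
    rw [hf, hf] at h
    exact (hinf.natEmbedding _).injective (Subtype.ext h)
  have hxi : 0 < x i := by
    have := congrFun hx i
    simp only [Pi.add_apply] at this
    omega
  rw [hx] at hq₁ hq₂
  have h₁ : Covers A (c + q.1) [] (c + (p.2 + x)) := by
    have := hp₂.shift x
    rw [add_comm x (f m), show x + (c + p.2) = c + (p.2 + x) by abel] at this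
    exact hq₁.trans this
  have h₂ : Covers A (c + (p.1 + x)) [] (c + q.2) := by
    have := hp₁.shift x
    rw [add_comm x (f m), show x + (c + p.1) = c + (p.1 + x) by abel] at this
    exact this.trans hq₂
  refine ⟨p.1 + (p.2 + x), ⟨p + q, hper.2 p hp q hq, ?_, ?_⟩, ?_⟩
  · exact (Covers.refl (c + p.1)).add_capacity h₁
  · have := (Covers.refl (c + p.2)).add_capacity h₂
    rwa [show p.2 + (p.1 + x) = p.1 + (p.2 + x) by abel] at this
  · simp only [Pi.add_apply]
    omega

theorem exists_covers_singleton (hper : PeriodicPairs P) {t : Trip d}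
    {e : PConf d × Act d × PConf d} (he : e ∈ Egamma A c P) (hact : t.2.1 = e.2.1)
    (hsrc : ∀ i, (t.1 i : ℕ∞) ≤ e.1 i) (htgt : ∀ i, (t.2.2 i : ℕ∞) ≤ e.2.2 i) :
    ∃ p ∈ P, Covers A (c + p.1) [t] (c + p.2) := by
  obtain ⟨t', ⟨⟨a, w, b⟩, ⟨hrun, p, hp, rfl, rfl⟩, ht'⟩, rfl⟩ := he
  obtain ⟨x, ⟨q, hq, hq₁, hq₂⟩, hx⟩ := (intraproductions A c hper).exists_mem_le_of_pos
    (Fgamma A c P) (fun _ hi => exists_intraproduction_pos hper hi) (t.1 + t.2.2)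
  obtain ⟨h₁, h₂⟩ := hrun.covers_of_mem ht'
  have hle : TripLE t (x + t'.1, t'.2.1, x + t'.2.2) := by
    refine ⟨hact, fun i => ?_, fun i => ?_⟩ <;> by_cases hi : i ∈ Fgamma A c P
    · have := hsrc i
      simp only [projPC, toPC, if_pos hi, Nat.cast_le] at this
      exact this.trans (Nat.le_add_left _ _)
    · have := hx i hi
      simp only [Pi.add_apply] at this ⊢
      omega
    · have := htgt i
      simp only [projPC, toPC, if_pos hi, Nat.cast_le] at this
      exact this.trans (Nat.le_add_left _ _)
    · have := hx i hi
      simp only [Pi.add_apply] at this ⊢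
      omega
  have hmid : Covers A (x + (c + p.1)) [t] (x + (c + p.2)) :=
    (h₁.shift x).trans (.keep (t := (x + t'.1, t'.2.1, x + t'.2.2))
      ((hrun.1 t' ht').shift x) hle (h₂.shift x))
  rw [show x + (c + p.1) = c + (x + p.1) by abel,
    show x + (c + p.2) = c + (x + p.2) by abel] at hmid
  refine ⟨q + p, hper.2 q hq p hp, ?_⟩
  exact ((hq₁.add_capacity (.refl (c + p.1))).trans hmid).trans
    (hq₂.add_capacity (.refl (c + p.2)))

theorem exists_covers_of_forall_mem (hper : PeriodicPairs P) (w : List (Trip d))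
    (hw : ∀ t ∈ w, ∃ e ∈ Egamma A c P, t.2.1 = e.2.1 ∧
      (∀ i, (t.1 i : ℕ∞) ≤ e.1 i) ∧ (∀ i, (t.2.2 i : ℕ∞) ≤ e.2.2 i)) :
    ∃ p ∈ P, Covers A (c + p.1) w (c + p.2) := by
  induction w with
  | nil => exact ⟨(0, 0), hper.1, .refl _⟩
  | cons t w ih =>
    rw [List.forall_mem_cons] at hw
    obtain ⟨⟨e, he, h₁, h₂, h₃⟩, hw⟩ := hw
    obtain ⟨p, hp, hcp⟩ := exists_covers_singleton hper he h₁ h₂ h₃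
    obtain ⟨q, hq, hcq⟩ := ih hw
    exact ⟨p + q, hper.2 p hp q hq, hcp.add_capacity hcq⟩

theorem exists_mem_le_fst (hper : PeriodicPairs P) {x : Conf d}
    (hx : ∀ i, (x i : ℕ∞) ≤ sinGamma c P i) : ∃ p ∈ P, ∀ i, x i ≤ (c + p.1) i := by
  obtain ⟨_, ⟨p, hp, rfl⟩, hle⟩ :=
    (hper.toAddSubmonoid.map (AddMonoidHom.fst _ _)).exists_mem_le_of_pos (FinGamma P)
    (fun i hi => by
      simp only [FinGamma, Set.mem_ofPred_eq, not_forall] at hi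
      obtain ⟨p, hp, hpi⟩ := hi
      exact ⟨p.1, ⟨p, hp, rfl⟩, Nat.pos_of_ne_zero hpi⟩) x
  refine ⟨p, hp, fun i => ?_⟩
  by_cases hi : i ∈ FinGamma P
  · have := hx i
    simp only [sinGamma, projPC, toPC, if_pos hi, Nat.cast_le] at this
    exact this.trans (Nat.le_add_right _ _)
  · exact (hle i hi).trans (Nat.le_add_left _ _)

theorem exists_mem_le_snd (hper : PeriodicPairs P) {y : Conf d}
    (hy : ∀ i, (y i : ℕ∞) ≤ soutGamma c P i) : ∃ p ∈ P, ∀ i, y i ≤ (c + p.2) i := by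
  obtain ⟨_, ⟨p, hp, rfl⟩, hle⟩ :=
    (hper.toAddSubmonoid.map (AddMonoidHom.snd _ _)).exists_mem_le_of_pos (FoutGamma P)
    (fun i hi => by
      simp only [FoutGamma, Set.mem_ofPred_eq, not_forall] at hi
      obtain ⟨p, hp, hpi⟩ := hi
      exact ⟨p.2, ⟨p, hp, rfl⟩, Nat.pos_of_ne_zero hpi⟩) y
  refine ⟨p, hp, fun i => ?_⟩
  by_cases hi : i ∈ FoutGamma P
  · have := hy i
    simp only [soutGamma, projPC, toPC, if_pos hi, Nat.cast_le] at this
    exact this.trans (Nat.le_add_right _ _)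
  · exact (hle i hi).trans (Nat.le_add_left _ _)

theorem le_projPC {F : Set (Fin d)} {m : ℕ} {u : Conf d} {i : Fin d}
    (h : i ∈ F → m ≤ u i) : (m : ℕ∞) ≤ projPC F (toPC u) i := by
  by_cases hi : i ∈ F
  · simpa [projPC, toPC, hi] using h hi
  · simp [projPC, hi]

end Periodic

/-- Let `γ = (c, P)` with `P ⊆ ℕ^d × ℕ^d` periodic and included in `↝_c`.
Then `↓Ω_γ = ↓s_γ^in × (↓E_γ)* × ↓s_γ^out`: the downward closure of `Ω_γ`
inside `(PreRuns_A, ⊴)` is the set of preruns `(x, w, y)` with `x ≤ s_γ^in`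
and `y ≤ s_γ^out` componentwise (in `ℕ_ω^d`), and every letter of `w` below
some element of `E_γ` (same action, componentwise smaller source and
target). -/
theorem omega_gamma_downward_closure {d : ℕ} (A : Set (Act d)) (hA : A.Finite)
    (c : Conf d) (P : Set (Conf d × Conf d)) (hper : PeriodicPairs P)
    (hPc : ∀ p ∈ P, Transformer A c p.1 p.2) :
    DownIn A {ρ : PreRun d | InOmega A c P ρ} =
      {ρ : PreRun d |
        (∀ i, (ρ.1 i : ℕ∞) ≤ sinGamma c P i) ∧
        (∀ i, (ρ.2.2 i : ℕ∞) ≤ soutGamma c P i) ∧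
        ∀ t ∈ ρ.2.1, ∃ e ∈ Egamma A c P, t.2.1 = e.2.1 ∧
          (∀ i, (t.1 i : ℕ∞) ≤ e.1 i) ∧ (∀ i, (t.2.2 i : ℕ∞) ≤ e.2.2 i)} := by
  ext ⟨x, w, y⟩
  constructor
  · rintro ⟨-, ρ', hΩ, hx, hy, hemb⟩
    obtain ⟨hrun, p, hp, hp₁, hp₂⟩ := id hΩ
    refine ⟨fun i => le_projPC fun hi => ?_, fun i => le_projPC fun hi => ?_, fun t ht => ?_⟩
    · have := hx i
      rwa [hp₁, Pi.add_apply, hi p hp] at this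
    · have := hy i
      rwa [hp₂, Pi.add_apply, hi p hp] at this
    · obtain ⟨t', ht', hact, hsrc, htgt⟩ := hemb.exists_of_mem ht
      exact ⟨_, ⟨t', ⟨ρ', hΩ, ht'⟩, rfl⟩, hact, fun i => le_projPC fun _ => hsrc i,
        fun i => le_projPC fun _ => htgt i⟩
  · rintro ⟨hx, hy, hw⟩
    refine ⟨fun t ht => ?_, ?_⟩
    · obtain ⟨_, ⟨t', ⟨ρ, hρ, ht'⟩, rfl⟩, hact, -⟩ := hw t ht
      rw [hact]
      exact (hρ.1.1 t' ht').1
    · obtain ⟨p, hp, hpw⟩ := exists_covers_of_forall_mem hper w hw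
      obtain ⟨q, hq, hqx⟩ := exists_mem_le_fst hper hx
      obtain ⟨r, hr, hry⟩ := exists_mem_le_snd hper hy
      have hnil : ∀ q ∈ P, Covers A (c + q.1) [] (c + q.2) := fun q hq => by
        obtain ⟨v, hv⟩ := hPc q hq
        rw [add_comm c, add_comm c]
        exact hv.covers_nil
      obtain ⟨v, hv, hemb⟩ :=
        (((hnil q hq).add_capacity (hnil r hr)).add_capacity hpw).exists_isRun
      refine ⟨_, ⟨hv, q + r + p, hper.2 _ (hper.2 q hq r hr) p hp, rfl, rfl⟩,
        fun i => ?_, fun i => ?_, hemb⟩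
      · have := hqx i
        simp only [Pi.add_apply] at this ⊢
        omega
      · have := hry i
        simp only [Pi.add_apply] at this ⊢
        omega
end
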